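/- arXiv:2512.17823 — 2 statements merged into one kernel-verified Lean document; each statement's English description precedes it below -/
import Mathlib

section
/- Let X : ℤ² → (0,∞) be strictly positive vertex weights, m,n ≥ 1, integers 1 ≤ a ≤ m, 1 ≤ b ≤ n, and 1 ≤ k ≤ min(a, n−b+1). Writing T_j = T_j((1,1),(m,n)), one has T([(1,1)^{k−1},(a,1)],[(m,n)^k]) · T([(1,1)^k],[(m,n)^{k−1},(m,b)]) / (T_k · T_{k−1}) = T([(1,1)^{k−1},(a,1)],[(m,n)^{k−1},(m,b)]) / T_{k−1} − T([(1,1)^k,(a,1)],[(m,n)^k,(m,b)]) / T_k, where [(1,1)^{k−1},(a,1)] denotes the list (1,1),…,(k−1,1),(a,1), [(m,n)^{k−1},(m,b)] the list (m,n),…,(m,n−k+2),(m,b), [(1,1)^k,(a,1)] the list (1,1),…,(k,1),(a,1), and [(m,n)^k,(m,b)] the list (m,n),…,(m,n−k+1),(m,b); in particular, when k = min(a, n−b+1) the second term on the right-hand side equals 0. -/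
open scoped BigOperators

/-! ### Directed paths and partition functions -/

/-- One step of an up-right path in `ℤ²`: one coordinate increases by `1`. -/
def UpStep (p q : ℤ × ℤ) : Prop :=
  (q.1 = p.1 + 1 ∧ q.2 = p.2) ∨ (q.1 = p.1 ∧ q.2 = p.2 + 1)

/-- `γ` is a directed path from `u` to `v` for the step relation `E`. -/
def IsDirPath {α : Type*} (E : α → α → Prop) (γ : List α) (u v : α) : Prop :=
  γ.head? = some u ∧ γ.getLast? = some v ∧ γ.Chain' E

/-- Tuples of pairwise vertex-disjoint directed paths, the `i`-th from `u i` to `v i`. -/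
def DisjointPathTuples {α : Type*} (E : α → α → Prop) {k : ℕ} (u v : Fin k → α) :
    Set (Fin k → List α) :=
  {γ | (∀ i, IsDirPath E (γ i) (u i) (v i)) ∧ ∀ i j, i ≠ j → ∀ w ∈ γ i, w ∉ γ j}

/-- The product of the vertex weights over all vertices lying on some path of the tuple. -/
noncomputable def tupleWeight {α : Type*} [DecidableEq α] (Y : α → ℝ) {k : ℕ}
    (γ : Fin k → List α) : ℝ :=
  ∏ w ∈ Finset.univ.biUnion (fun i => (γ i).toFinset), Y w

/-- The `k`-path partition function in the directed graph with step relation `E` and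
vertex weights `Y` (an empty sum is `0`; there are only finitely many relevant paths,
so the `tsum` below is a finite sum). -/
noncomputable def dirPF {α : Type*} [DecidableEq α] (E : α → α → Prop) (Y : α → ℝ) {k : ℕ}
    (u v : Fin k → α) : ℝ :=
  ∑' γ : DisjointPathTuples E u v, tupleWeight Y (γ : Fin k → List α)

/-- The `k`-path partition function `T([u₁,…,u_k],[v₁,…,v_k])` for vertex weights `X` on `ℤ²`. -/
noncomputable def TT (X : ℤ × ℤ → ℝ) {k : ℕ} (u v : Fin k → ℤ × ℤ) : ℝ :=
  dirPF UpStep X u v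

/-- The one-path partition function `T₁(u,v)`. -/
noncomputable def T1 (X : ℤ × ℤ → ℝ) (u v : ℤ × ℤ) : ℝ :=
  TT X (fun _ : Fin 1 => u) (fun _ : Fin 1 => v)

/-- `T_k(u,v)`, with `T_0(u,v) = 1`: the `i`-th path goes from `u + (i-1,0)` to `v + (i-k,0)`,
`i = 1,…,k`. -/
noncomputable def Tk (X : ℤ × ℤ → ℝ) (k : ℕ) (u v : ℤ × ℤ) : ℝ :=
  if k = 0 then 1
  else TT X (fun i : Fin k => (u.1 + (i : ℕ), u.2))
    (fun i : Fin k => (v.1 + (i : ℕ) - (k - 1 : ℤ), v.2))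

/-- `Z_j(u,v) = T_j(u,v)/T_{j-1}(u,v)` when `T_{j-1}(u,v) > 0`, and `0` otherwise. -/
noncomputable def Zj (X : ℤ × ℤ → ℝ) (j : ℤ) (u v : ℤ × ℤ) : ℝ :=
  if 0 < Tk X (j - 1).toNat u v then Tk X j.toNat u v / Tk X (j - 1).toNat u v else 0

/-- `Z^{m,n}_j(i)`: equal to `Z_j((1,1),(i,n))` for `i ≤ m` and to `Z_j((1,i-m),(m,n))`
for `i > m`. -/
noncomputable def Zmn (X : ℤ × ℤ → ℝ) (m n : ℤ) (j i : ℤ) : ℝ :=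
  if i ≤ m then Zj X j ((1 : ℤ), (1 : ℤ)) (i, n) else Zj X j ((1 : ℤ), i - m) (m, n)

/-! ### The line-ensemble graph -/

/-- `(i,j) ∈ J₁[m,n]`. -/
def J1 (m n i j : ℤ) : Prop := 1 ≤ i ∧ i ≤ m ∧ 1 ≤ j ∧ j ≤ min i n

/-- `(i,j) ∈ J₂[m,n]`. -/
def J2 (m n i j : ℤ) : Prop := m + 1 ≤ i ∧ i ≤ m + n ∧ 1 ≤ j ∧ j ≤ min (m + n + 1 - i) m

/-- `(i,j) ∈ J[m,n] = J₁[m,n] ∪ J₂[m,n]`. -/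
def Jmem (m n i j : ℤ) : Prop := J1 m n i j ∨ J2 m n i j

/-- `(i,j) ∈ V₁[m,n]`, i.e. `(i, n+1-j) ∈ J₁[m,n]`. -/
def V1 (m n i j : ℤ) : Prop := J1 m n i (n + 1 - j)

/-- `(i,j) ∈ V₂[m,n]`, i.e. `(i, n+1-j) ∈ J₂[m,n]`. -/
def V2 (m n i j : ℤ) : Prop := J2 m n i (n + 1 - j)

instance (m n i j : ℤ) : Decidable (J1 m n i j) := by unfold J1; infer_instance
instance (m n i j : ℤ) : Decidable (J2 m n i j) := by unfold J2; infer_instance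
instance (m n i j : ℤ) : Decidable (Jmem m n i j) := by unfold Jmem; infer_instance
instance (m n i j : ℤ) : Decidable (V1 m n i j) := by unfold V1; infer_instance
instance (m n i j : ℤ) : Decidable (V2 m n i j) := by unfold V2; infer_instance

/-- Vertices of the line-ensemble graph: `Sum.inl (i,j)` is the integer vertex `(i,j)`,
and `Sum.inr j` is the auxiliary vertex `(m + ½, j)`. -/
abbrev LVtx : Type := (ℤ × ℤ) ⊕ ℤ

/-- The edges of the line-ensemble graph: right/up edges within `V₁[m,n]`, right/down edges
within `V₂[m,n]`, and the edges `(m,j) → (m+½,j) → (m+1,j)`. -/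
def LEdge (m n : ℤ) : LVtx → LVtx → Prop
  | Sum.inl p, Sum.inl q =>
      (V1 m n p.1 p.2 ∧ V1 m n q.1 q.2 ∧
        ((q.1 = p.1 + 1 ∧ q.2 = p.2) ∨ (q.1 = p.1 ∧ q.2 = p.2 + 1))) ∨
      (V2 m n p.1 p.2 ∧ V2 m n q.1 q.2 ∧
        ((q.1 = p.1 + 1 ∧ q.2 = p.2) ∨ (q.1 = p.1 ∧ q.2 = p.2 - 1)))
  | Sum.inl p, Sum.inr j => p.1 = m ∧ p.2 = j ∧ 1 ≤ j ∧ j ≤ min m n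
  | Sum.inr j, Sum.inl q => q.1 = m + 1 ∧ q.2 = j ∧ 1 ≤ j ∧ j ≤ min m n
  | Sum.inr _, Sum.inr _ => False

/-- The weights `Y[z]` on the line-ensemble graph built from an array `z`, where `z j i`
stands for `z_j(i)` (with the convention `z_j(0) = 1`). -/
noncomputable def Yw (m n : ℤ) (z : ℤ → ℤ → ℝ) : LVtx → ℝ
  | Sum.inl p =>
      if V1 m n p.1 p.2 then
        z (n + 1 - p.2) p.1 / (if p.1 = 1 then 1 else z (n + 1 - p.2) (p.1 - 1))
      else if V2 m n p.1 p.2 then z (n + 1 - p.2) p.1 / z (n + 1 - p.2) (p.1 + 1)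
      else 0
  | Sum.inr j => (z (n + 1 - j) m)⁻¹

/-- The partition function `S[z]` in the line-ensemble graph with parameters `(m,n)`. -/
noncomputable def SS (m n : ℤ) (z : ℤ → ℤ → ℝ) {k : ℕ} (u v : Fin k → LVtx) : ℝ :=
  dirPF (LEdge m n) (Yw m n z) u v

/-- `(x,1)^↑ = (x, max (n - x + 1) 1)`. -/
def upPt (n x : ℤ) : LVtx := Sum.inl (x, max (n - x + 1) 1)

/-- `(m,b)^→ = (m + b, b)`. -/
def rightPt (m b : ℤ) : LVtx := Sum.inl (m + b, b)

/-! ### Special lists of endpoints -/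

/-- The list `[(1,1),(2,1),…,(k-1,1),(a,1)]`. -/
def startList (a : ℤ) (k : ℕ) : Fin k → ℤ × ℤ :=
  fun i => if (i : ℕ) + 1 = k then (a, (1 : ℤ)) else (((i : ℕ) : ℤ) + 1, (1 : ℤ))

/-- The list `[(1,1),(2,1),…,(k,1)] = (1,1)^k`. -/
def botList (k : ℕ) : Fin k → ℤ × ℤ :=
  fun i => (((i : ℕ) : ℤ) + 1, (1 : ℤ))

/-- The list `[(m,n),(m,n-1),…,(m,n-k+1)] = (m,n)^k`. -/
def topList (m n : ℤ) (k : ℕ) : Fin k → ℤ × ℤ :=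
  fun i => (m, n - ((i : ℕ) : ℤ))

/-- The list `[(m,n),(m,n-1),…,(m,n-k+2),(m,b)]`. -/
def endList (m n b : ℤ) (k : ℕ) : Fin k → ℤ × ℤ :=
  fun i => if (i : ℕ) + 1 = k then (m, b) else (m, n - ((i : ℕ) : ℤ))

/-! ### Basic facts on up-right paths -/

theorem not_path_nil (u v : ℤ × ℤ) : ¬ IsDirPath UpStep [] u v := by
  rintro ⟨h, -, -⟩
  simp at h

theorem path_cons_iff (p : ℤ × ℤ) (γ : List (ℤ × ℤ)) (u v : ℤ × ℤ) :
    IsDirPath UpStep (p :: γ) u v ↔ p = u ∧ ((γ = [] ∧ u = v) ∨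
      IsDirPath UpStep γ (u.1 + 1, u.2) v ∨ IsDirPath UpStep γ (u.1, u.2 + 1) v) := by
  unfold IsDirPath List.Chain'
  cases γ with
  | nil =>
    simp only [List.head?_cons, List.getLast?_singleton, Option.some.injEq, List.head?_nil]
    constructor
    · rintro ⟨h1, h2, -⟩
      exact ⟨h1, Or.inl ⟨trivial, h1 ▸ h2⟩⟩
    · rintro ⟨h1, h2⟩
      rcases h2 with ⟨-, h⟩ | ⟨h, -⟩ | ⟨h, -⟩
      · exact ⟨h1, h1.trans h, by simp⟩
      · simp at h
      · simp at h
  | cons q γ =>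
    rw [List.isChain_cons_cons, List.getLast?_cons_cons]
    simp only [List.head?_cons, Option.some.injEq]
    constructor
    · rintro ⟨rfl, h2, h3, h4⟩
      refine ⟨rfl, Or.inr ?_⟩
      rcases h3 with ⟨a, b⟩ | ⟨a, b⟩
      · exact Or.inl ⟨Prod.ext a b, h2, h4⟩
      · exact Or.inr ⟨Prod.ext a b, h2, h4⟩
    · rintro ⟨rfl, h⟩
      rcases h with ⟨h, -⟩ | ⟨rfl, h, h'⟩ | ⟨rfl, h, h'⟩
      · simp at h
      · exact ⟨rfl, h, Or.inl ⟨rfl, rfl⟩, h'⟩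
      · exact ⟨rfl, h, Or.inr ⟨rfl, rfl⟩, h'⟩

theorem path_le {γ : List (ℤ × ℤ)} : ∀ {u v : ℤ × ℤ}, IsDirPath UpStep γ u v →
    ∀ w ∈ γ, u.1 ≤ w.1 ∧ u.2 ≤ w.2 := by
  induction γ with
  | nil => intro u v h; exact absurd h (not_path_nil u v)
  | cons p γ ih =>
    intro u v h w hw
    rw [path_cons_iff] at h
    obtain ⟨rfl, h⟩ := h
    rcases List.mem_cons.1 hw with rfl | hw
    · exact ⟨le_rfl, le_rfl⟩
    · rcases h with ⟨rfl, -⟩ | h | h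
      · simp at hw
      · have := ih h w hw
        simp only at this
        omega
      · have := ih h w hw
        simp only at this
        omega

theorem path_start_mem {γ : List (ℤ × ℤ)} {u v : ℤ × ℤ} (h : IsDirPath UpStep γ u v) : u ∈ γ :=
  List.mem_of_mem_head? h.1

theorem path_end_mem {γ : List (ℤ × ℤ)} {u v : ℤ × ℤ} (h : IsDirPath UpStep γ u v) : v ∈ γ :=
  List.mem_of_getLast? h.2.1

theorem path_start_unique {γ : List (ℤ × ℤ)} {u u' v v' : ℤ × ℤ} (h : IsDirPath UpStep γ u v)
    (h' : IsDirPath UpStep γ u' v') : u = u' := by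
  have := h.1.symm.trans h'.1
  simpa using this

theorem path_self_iff (γ : List (ℤ × ℤ)) (u : ℤ × ℤ) :
    IsDirPath UpStep γ u u ↔ γ = [u] := by
  cases γ with
  | nil => simp [not_path_nil]
  | cons p γ =>
    rw [path_cons_iff]
    constructor
    · rintro ⟨rfl, ⟨rfl, -⟩ | h | h⟩
      · rfl
      · have := path_le h _ (path_end_mem h)
        simp only at this
        omega
      · have := path_le h _ (path_end_mem h)
        simp only at this
        omega
    · intro h
      simp only [List.cons.injEq] at h
      exact ⟨h.1, Or.inl ⟨h.2, rfl⟩⟩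

theorem path_iff_of_ne {u v : ℤ × ℤ} (huv : u ≠ v) (γ : List (ℤ × ℤ)) :
    IsDirPath UpStep γ u v ↔ ∃ γ', γ = u :: γ' ∧
      (IsDirPath UpStep γ' (u.1 + 1, u.2) v ∨ IsDirPath UpStep γ' (u.1, u.2 + 1) v) := by
  cases γ with
  | nil => simp [not_path_nil]
  | cons p γ =>
    rw [path_cons_iff]
    constructor
    · rintro ⟨rfl, ⟨-, h⟩ | h⟩
      · exact absurd h huv
      · exact ⟨γ, rfl, h⟩
    · rintro ⟨γ', h, h'⟩
      simp only [List.cons.injEq] at h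
      obtain ⟨rfl, rfl⟩ := h
      exact ⟨rfl, Or.inr h'⟩

theorem paths_finite_aux (v : ℤ × ℤ) (N : ℕ) : ∀ u : ℤ × ℤ, v.1 + v.2 - (u.1 + u.2) < N →
    {γ | IsDirPath UpStep γ u v}.Finite := by
  induction N with
  | zero =>
    intro u hu
    convert Set.finite_empty
    ext γ
    simp only [Set.mem_ofPred_eq, Set.mem_empty_iff_false, iff_false]
    intro h
    have := path_le h _ (path_end_mem h)
    simp at hu
    omega
  | succ N ih =>
    intro u hu
    by_cases huv : u = v
    · subst huv
      simp only [path_self_iff, Set.ofPred_eq_eq_singleton, Set.finite_singleton]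
    · have h1 := ih (u.1 + 1, u.2) (by push_cast at hu ⊢; omega)
      have h2 := ih (u.1, u.2 + 1) (by push_cast at hu ⊢; omega)
      refine ((h1.union h2).image (fun γ => u :: γ)).subset ?_
      intro γ hγ
      obtain ⟨γ', rfl, h⟩ := (path_iff_of_ne huv γ).1 hγ
      exact ⟨γ', h, rfl⟩

theorem paths_finite (u v : ℤ × ℤ) : {γ | IsDirPath UpStep γ u v}.Finite :=
  paths_finite_aux v ((v.1 + v.2 - (u.1 + u.2)).toNat + 1) u (by push_cast; omega)

theorem tuples_finite {k : ℕ} (u v : Fin k → ℤ × ℤ) : (DisjointPathTuples UpStep u v).Finite := by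
  refine (Set.Finite.pi' (fun i => paths_finite (u i) (v i))).subset ?_
  intro γ hγ i
  exact hγ.1 i

theorem TT_eq_zero (X : ℤ × ℤ → ℝ) {k : ℕ} (u v : Fin k → ℤ × ℤ)
    (h : ∀ γ, γ ∉ DisjointPathTuples UpStep u v) : TT X u v = 0 := by
  unfold TT dirPF
  have : IsEmpty (DisjointPathTuples UpStep u v) := ⟨fun x => h x.1 x.2⟩
  exact tsum_empty

theorem TT_not_inj_start (X : ℤ × ℤ → ℝ) {k : ℕ} (u v : Fin k → ℤ × ℤ) (i j : Fin k)
    (hij : i ≠ j) (h : u i = u j) : TT X u v = 0 := by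
  apply TT_eq_zero
  rintro γ ⟨h1, h2⟩
  exact h2 i j hij (u i) (path_start_mem (h1 i)) (h ▸ path_start_mem (h1 j))

theorem TT_not_inj_end (X : ℤ × ℤ → ℝ) {k : ℕ} (u v : Fin k → ℤ × ℤ) (i j : Fin k)
    (hij : i ≠ j) (h : v i = v j) : TT X u v = 0 := by
  apply TT_eq_zero
  rintro γ ⟨h1, h2⟩
  exact h2 i j hij (v i) (path_end_mem (h1 i)) (h ▸ path_end_mem (h1 j))

theorem TT_start_hits_end (X : ℤ × ℤ → ℝ) {k : ℕ} (u v : Fin k → ℤ × ℤ) (i j : Fin k)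
    (hij : i ≠ j) (h : u i = v j) : TT X u v = 0 := by
  apply TT_eq_zero
  rintro γ ⟨h1, h2⟩
  exact h2 i j hij (u i) (path_start_mem (h1 i)) (h ▸ path_end_mem (h1 j))

theorem tupleWeight_insert (X : ℤ × ℤ → ℝ) {k l : ℕ} (γ : Fin k → List (ℤ × ℤ))
    (γ' : Fin l → List (ℤ × ℤ)) (p : ℤ × ℤ)
    (h : ∀ w, (∃ i, w ∈ γ' i) ↔ w = p ∨ ∃ i, w ∈ γ i) (hp : ∀ i, p ∉ γ i) :
    tupleWeight X γ' = X p * tupleWeight X γ := by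
  unfold tupleWeight
  rw [← Finset.prod_insert]
  · congr 1
    ext w
    simpa using h w
  · simpa using hp

/-! ### Peeling off a starting vertex -/

theorem TT_peel (X : ℤ × ℤ → ℝ) {k : ℕ} (u v : Fin k → ℤ × ℤ) (i : Fin k)
    (hinj : Function.Injective u)
    (hmin : ∀ j, (u i).1 + (u i).2 ≤ (u j).1 + (u j).2) (huv : u i ≠ v i) :
    TT X u v = X (u i) * (TT X (Function.update u i ((u i).1 + 1, (u i).2)) v +
      TT X (Function.update u i ((u i).1, (u i).2 + 1)) v) := by
  set u1 := Function.update u i ((u i).1 + 1, (u i).2) with hu1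
  set u2 := Function.update u i ((u i).1, (u i).2 + 1) with hu2
  set f : (Fin k → List (ℤ × ℤ)) → (Fin k → List (ℤ × ℤ)) :=
    fun γ => Function.update γ i (u i :: γ i) with hf
  have hfi : Function.Injective f := by
    intro γ γ' h
    funext j
    have hj := congrFun h j
    by_cases hji : j = i
    · subst hji
      simpa [hf] using hj
    · simpa [hf, hji] using hj
  -- vertices on later paths avoid `u i`
  have key : ∀ u' : Fin k → ℤ × ℤ, (u' = u1 ∨ u' = u2) → ∀ γ ∈ DisjointPathTuples UpStep u' v,
      ∀ j, u i ∉ γ j := by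
    intro u' hu' γ hγ j hj
    have hle := path_le (hγ.1 j) _ hj
    by_cases hji : j = i
    · subst hji
      rcases hu' with rfl | rfl
      · simp [hu1] at hle
      · simp [hu2] at hle
    · have e : u' j = u j := by
        rcases hu' with rfl | rfl
        · simp [hu1, hji]
        · simp [hu2, hji]
      rw [e] at hle
      have := hmin j
      exact hji (hinj (Prod.ext (by omega) (by omega)))
  have hw : ∀ u' : Fin k → ℤ × ℤ, (u' = u1 ∨ u' = u2) → ∀ γ ∈ DisjointPathTuples UpStep u' v,
      tupleWeight X (f γ) = X (u i) * tupleWeight X γ := by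
    intro u' hu' γ hγ
    apply tupleWeight_insert _ _ _ _ _ (key u' hu' γ hγ)
    intro w
    constructor
    · rintro ⟨j, hj⟩
      by_cases hji : j = i
      · subst hji
        simp only [hf, Function.update_self, List.mem_cons] at hj
        exact hj.imp id (fun h => ⟨j, h⟩)
      · simp only [hf, Function.update_of_ne hji] at hj
        exact Or.inr ⟨j, hj⟩
    · rintro (rfl | ⟨j, hj⟩)
      · exact ⟨i, by simp [hf]⟩
      · refine ⟨j, ?_⟩
        by_cases hji : j = i
        · subst hji
          simp [hf, hj]
        · simpa [hf, hji] using hj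
  have hset : DisjointPathTuples UpStep u v =
      f '' DisjointPathTuples UpStep u1 v ∪ f '' DisjointPathTuples UpStep u2 v := by
    ext γ
    constructor
    · rintro ⟨h1, h2⟩
      obtain ⟨γ', hγ', h⟩ := (path_iff_of_ne huv _).1 (h1 i)
      have hfe : f (Function.update γ i γ') = γ := by
        simp only [hf, Function.update_self, Function.update_idem]
        rw [← hγ', Function.update_eq_self]
      have hd : ∀ a b, a ≠ b → ∀ w ∈ Function.update γ i γ' a, w ∉ Function.update γ i γ' b := by
        intro a b hab w hwa hwb
        have hs : ∀ c, w ∈ Function.update γ i γ' c → w ∈ γ c := by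
          intro c hc
          by_cases hci : c = i
          · subst hci
            simp only [Function.update_self] at hc
            rw [hγ']
            exact List.mem_cons_of_mem _ hc
          · simpa [hci] using hc
        exact h2 a b hab w (hs a hwa) (hs b hwb)
      rcases h with h | h
      · refine Or.inl ⟨Function.update γ i γ', ⟨?_, hd⟩, hfe⟩
        intro j
        by_cases hji : j = i
        · subst hji
          simpa [hu1] using h
        · simpa [hu1, hji] using h1 j
      · refine Or.inr ⟨Function.update γ i γ', ⟨?_, hd⟩, hfe⟩
        intro j
        by_cases hji : j = i
        · subst hji
          simpa [hu2] using h
        · simpa [hu2, hji] using h1 j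
    · have main : ∀ u' : Fin k → ℤ × ℤ, (u' = u1 ∨ u' = u2) →
          ∀ γ ∈ DisjointPathTuples UpStep u' v, f γ ∈ DisjointPathTuples UpStep u v := by
        intro u' hu' γ hγ
        have hk := key u' hu' γ hγ
        constructor
        · intro j
          by_cases hji : j = i
          · subst hji
            have := hγ.1 j
            rw [path_iff_of_ne huv]
            refine ⟨γ j, by simp [hf], ?_⟩
            rcases hu' with rfl | rfl
            · left; simpa [hu1] using this
            · right; simpa [hu2] using this
          · have := hγ.1 j
            rcases hu' with rfl | rfl
            · simpa [hf, hji, hu1] using this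
            · simpa [hf, hji, hu2] using this
        · intro a b hab w hwa hwb
          by_cases hai : a = i
          · subst hai
            simp only [hf, Function.update_self, Function.update_of_ne hab.symm,
              List.mem_cons] at hwa hwb
            rcases hwa with rfl | hwa
            · exact hk b hwb
            · exact hγ.2 a b hab w hwa hwb
          · simp only [hf, Function.update_of_ne hai] at hwa
            by_cases hbi : b = i
            · subst hbi
              simp only [hf, Function.update_self, List.mem_cons] at hwb
              rcases hwb with rfl | hwb
              · exact hk a hwa
              · exact hγ.2 a b hab w hwa hwb
            · simp only [hf, Function.update_of_ne hbi] at hwb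
              exact hγ.2 a b hab w hwa hwb
      rintro (⟨γ', h, rfl⟩ | ⟨γ', h, rfl⟩)
      · exact main _ (Or.inl rfl) _ h
      · exact main _ (Or.inr rfl) _ h
  have hdis : Disjoint (f '' DisjointPathTuples UpStep u1 v)
      (f '' DisjointPathTuples UpStep u2 v) := by
    rw [Set.disjoint_image_iff hfi, Set.disjoint_left]
    intro γ h1 h2
    have := path_start_unique (h1.1 i) (h2.1 i)
    simp [hu1, hu2] at this
  have fin1 : Finite (f '' DisjointPathTuples UpStep u1 v) := (tuples_finite u1 v).image f
  have fin2 : Finite (f '' DisjointPathTuples UpStep u2 v) := (tuples_finite u2 v).image f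
  unfold TT dirPF
  rw [hset, Summable.tsum_union_disjoint hdis Summable.of_finite Summable.of_finite,
    tsum_image _ hfi.injOn, tsum_image _ hfi.injOn, mul_add, ← tsum_mul_left, ← tsum_mul_left]
  congr 1
  · exact tsum_congr (fun γ => hw _ (Or.inl rfl) _ γ.2)
  · exact tsum_congr (fun γ => hw _ (Or.inr rfl) _ γ.2)

/-! ### Removing a trivial path -/

theorem TT_delete (X : ℤ × ℤ → ℝ) {k : ℕ} (u v : Fin (k + 1) → ℤ × ℤ) (i : Fin (k + 1))
    (hinj : Function.Injective u)
    (hmin : ∀ j, (u i).1 + (u i).2 ≤ (u j).1 + (u j).2) (huv : u i = v i) :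
    TT X u v = X (u i) * TT X (fun j => u (i.succAbove j)) (fun j => v (i.succAbove j)) := by
  set f : (Fin k → List (ℤ × ℤ)) → (Fin (k + 1) → List (ℤ × ℤ)) :=
    fun γ => Fin.insertNth (α := fun _ => List (ℤ × ℤ)) i [u i] γ with hf
  have fi : ∀ γ, f γ i = [u i] := fun γ => Fin.insertNth_apply_same _ _ _
  have fs : ∀ γ j, f γ (i.succAbove j) = γ j := fun γ j => Fin.insertNth_apply_succAbove _ _ _ _
  have hfi : Function.Injective f := by
    intro γ γ' h
    funext j
    have := congrFun h (i.succAbove j)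
    rwa [fs, fs] at this
  have key : ∀ γ ∈ DisjointPathTuples UpStep (fun j => u (i.succAbove j))
      (fun j => v (i.succAbove j)), ∀ j, u i ∉ γ j := by
    intro γ hγ j hj
    have hle := path_le (hγ.1 j) _ hj
    have := hmin (i.succAbove j)
    exact Fin.succAbove_ne i j (hinj (Prod.ext (by simp only at hle; omega) (by simp only at hle; omega)))
  have hset : DisjointPathTuples UpStep u v = f '' DisjointPathTuples UpStep
      (fun j => u (i.succAbove j)) (fun j => v (i.succAbove j)) := by
    ext γ
    constructor
    · rintro ⟨h1, h2⟩
      refine ⟨fun j => γ (i.succAbove j), ⟨fun j => h1 _, fun a b hab => h2 _ _ ?_⟩, ?_⟩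
      · exact fun h => hab (Fin.succAbove_right_injective h)
      · funext j
        rcases Fin.eq_self_or_eq_succAbove i j with rfl | ⟨j, rfl⟩
        · have := h1 j
          rw [← huv, path_self_iff] at this
          rw [fi, this]
        · rw [fs]
    · rintro ⟨γ, hγ, rfl⟩
      have hk := key γ hγ
      constructor
      · intro j
        rcases Fin.eq_self_or_eq_succAbove i j with rfl | ⟨j, rfl⟩
        · rw [fi, ← huv, path_self_iff]
        · rw [fs]
          exact hγ.1 j
      · intro a b hab w hwa hwb
        rcases Fin.eq_self_or_eq_succAbove i a with rfl | ⟨a, rfl⟩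
        · rcases Fin.eq_self_or_eq_succAbove a b with rfl | ⟨b, rfl⟩
          · exact hab rfl
          · rw [fi, List.mem_singleton] at hwa
            rw [fs] at hwb
            subst hwa
            exact hk b hwb
        · rw [fs] at hwa
          rcases Fin.eq_self_or_eq_succAbove i b with rfl | ⟨b, rfl⟩
          · rw [fi, List.mem_singleton] at hwb
            subst hwb
            exact hk a hwa
          · rw [fs] at hwb
            exact hγ.2 a b (fun h => hab (h ▸ rfl)) w hwa hwb
  unfold TT dirPF
  rw [hset, tsum_image _ hfi.injOn, ← tsum_mul_left]
  refine tsum_congr (fun γ => ?_)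
  apply tupleWeight_insert _ _ _ _ _ (key γ.1 γ.2)
  intro w
  constructor
  · rintro ⟨j, hj⟩
    rcases Fin.eq_self_or_eq_succAbove i j with rfl | ⟨j, rfl⟩
    · rw [fi, List.mem_singleton] at hj
      exact Or.inl hj
    · rw [fs] at hj
      exact Or.inr ⟨j, hj⟩
  · rintro (rfl | ⟨j, hj⟩)
    · exact ⟨i, by rw [fi]; simp⟩
    · exact ⟨i.succAbove j, by rw [fs]; exact hj⟩

theorem TT_zero (X : ℤ × ℤ → ℝ) (u v : Fin 0 → ℤ × ℤ) : TT X u v = 1 := by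
  unfold TT dirPF
  have : DisjointPathTuples UpStep u v = {fun i => i.elim0} := by
    ext γ
    simp only [Set.mem_singleton_iff]
    constructor
    · intro _
      funext i
      exact i.elim0
    · intro _
      exact ⟨fun i => i.elim0, fun i => i.elim0⟩
  rw [this, tsum_singleton]
  simp [tupleWeight]

/-! ### One-path Green function by recursion -/

noncomputable def hrec (X : ℤ × ℤ → ℝ) : ℕ → ℤ × ℤ → ℤ × ℤ → ℝ
  | 0, u, v => if u = v then X u else 0
  | (N + 1), u, v => if u = v then X u else
      X u * (hrec X N (u.1 + 1, u.2) v + hrec X N (u.1, u.2 + 1) v)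

noncomputable def hh (X : ℤ × ℤ → ℝ) (u v : ℤ × ℤ) : ℝ :=
  hrec X (v.1 + v.2 - (u.1 + u.2)).toNat u v

theorem hh_self (X : ℤ × ℤ → ℝ) (u : ℤ × ℤ) : hh X u u = X u := by
  simp [hh, hrec]

theorem hrec_zero (X : ℤ × ℤ → ℝ) (N : ℕ) : ∀ u v : ℤ × ℤ, ¬ (u.1 ≤ v.1 ∧ u.2 ≤ v.2) →
    hrec X N u v = 0 := by
  induction N with
  | zero =>
    intro u v h
    rw [hrec, if_neg]
    rintro rfl
    exact h ⟨le_rfl, le_rfl⟩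
  | succ N ih =>
    intro u v h
    rw [hrec, if_neg, ih, ih]
    · simp
    · simp only; omega
    · simp only; omega
    · rintro rfl
      exact h ⟨le_rfl, le_rfl⟩

theorem hh_zero (X : ℤ × ℤ → ℝ) (u v : ℤ × ℤ) (h : ¬ (u.1 ≤ v.1 ∧ u.2 ≤ v.2)) :
    hh X u v = 0 := hrec_zero X _ u v h

theorem hh_le (X : ℤ × ℤ → ℝ) (u v : ℤ × ℤ) (h : hh X u v ≠ 0) : u.1 ≤ v.1 ∧ u.2 ≤ v.2 := by
  by_contra h'
  exact h (hh_zero X u v h')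

theorem hh_start (X : ℤ × ℤ → ℝ) (u v : ℤ × ℤ) (huv : u ≠ v) :
    hh X u v = X u * (hh X (u.1 + 1, u.2) v + hh X (u.1, u.2 + 1) v) := by
  by_cases hs : u.1 + u.2 < v.1 + v.2
  · obtain ⟨N, hN⟩ : ∃ N : ℕ, v.1 + v.2 - (u.1 + u.2) = N + 1 :=
      ⟨(v.1 + v.2 - (u.1 + u.2) - 1).toNat, by omega⟩
    unfold hh
    have e0 : (v.1 + v.2 - (u.1 + u.2)).toNat = N + 1 := by omega
    have e1 : (v.1 + v.2 - (u.1 + 1 + u.2)).toNat = N := by omega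
    have e2 : (v.1 + v.2 - (u.1 + (u.2 + 1))).toNat = N := by omega
    simp only [e0, e1, e2]
    rw [hrec, if_neg huv]
  · have hne : ¬ (u.1 ≤ v.1 ∧ u.2 ≤ v.2) := by
      intro h
      exact huv (Prod.ext (by omega) (by omega))
    rw [hh_zero X u v hne, hh_zero, hh_zero]
    · simp
    · simp only; omega
    · simp only; omega

theorem hh_end_aux (X : ℤ × ℤ → ℝ) (v : ℤ × ℤ) (N : ℕ) : ∀ u : ℤ × ℤ, u ≠ v →
    v.1 + v.2 - (u.1 + u.2) < N →
    hh X u v = X v * (hh X u (v.1 - 1, v.2) + hh X u (v.1, v.2 - 1)) := by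
  induction N with
  | zero =>
    intro u huv hN
    push_cast at hN
    rw [hh_zero, hh_zero, hh_zero]
    · simp
    · simp only; omega
    · simp only; omega
    · omega
  | succ N ih =>
    intro u huv hN
    push_cast at hN
    -- right-hand sides of the two induction hypotheses, allowing equality
    by_cases h1 : u = (v.1 - 1, v.2)
    · have hv : v = (u.1 + 1, u.2) := by rw [h1]; simp
      rw [hh_start X u v huv, ← hv, hh_self, hh_zero X _ v, ← h1, hh_self, hh_zero X u]
      · ring
      · rw [hv]; simp
      · rw [hv]; simp
    · by_cases h2 : u = (v.1, v.2 - 1)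
      · have hv : v = (u.1, u.2 + 1) := by rw [h2]; simp
        rw [hh_start X u v huv, ← hv, hh_self, hh_zero X _ v, ← h2, hh_self, hh_zero X u]
        · ring
        · rw [hv]; simp
        · rw [hv]; simp
      · have a1 : ((u.1 + 1, u.2) : ℤ × ℤ) ≠ v := by
          rintro rfl; simp at h1
        have a2 : ((u.1, u.2 + 1) : ℤ × ℤ) ≠ v := by
          rintro rfl; simp at h2
        rw [hh_start X u v huv, ih _ a1 (by simp only; omega), ih _ a2 (by simp only; omega),
          hh_start X u _ h1, hh_start X u _ h2]
        ring

theorem hh_end (X : ℤ × ℤ → ℝ) (u v : ℤ × ℤ) (huv : u ≠ v) :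
    hh X u v = X v * (hh X u (v.1 - 1, v.2) + hh X u (v.1, v.2 - 1)) :=
  hh_end_aux X v ((v.1 + v.2 - (u.1 + u.2)).toNat + 1) u huv (by push_cast; omega)

/-! ### The Lindström–Gessel–Viennot lemma -/

/-- Points listed weakly from north-west to south-east. -/
def NWSE {k : ℕ} (u : Fin k → ℤ × ℤ) : Prop :=
  ∀ i j, i ≤ j → (u i).1 ≤ (u j).1 ∧ (u j).2 ≤ (u i).2

noncomputable def HM (X : ℤ × ℤ → ℝ) {k : ℕ} (u v : Fin k → ℤ × ℤ) : Matrix (Fin k) (Fin k) ℝ :=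
  Matrix.of fun i j => hh X (u i) (v j)

theorem HM_det_hit (X : ℤ × ℤ → ℝ) {k : ℕ} (u v : Fin k → ℤ × ℤ) (hu : NWSE u) (hv : NWSE v)
    (hinj : Function.Injective u) (i j : Fin k)
    (hmin : ∀ l, (u i).1 + (u i).2 ≤ (u l).1 + (u l).2) (hij : i ≠ j) (h : u i = v j) :
    (HM X u v).det = 0 := by
  rw [Matrix.det_apply]
  refine Finset.sum_eq_zero (fun σ _ => ?_)
  suffices hz : ∏ l, HM X u v (σ l) l = 0 by rw [hz, smul_zero]
  by_contra hne
  rw [← ne_eq, Finset.prod_ne_zero_iff] at hne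
  have hle : ∀ l, (u (σ l)).1 ≤ (v l).1 ∧ (u (σ l)).2 ≤ (v l).2 :=
    fun l => hh_le X _ _ (hne l (Finset.mem_univ l))
  have huniq : ∀ l, (u l).1 ≤ (u i).1 → (u l).2 ≤ (u i).2 → l = i := by
    intro l h1 h2
    have := hmin l
    exact hinj (Prod.ext (by omega) (by omega))
  have hσj : σ j = i := by
    have := hle j
    rw [← h] at this
    exact huniq _ this.1 this.2
  rcases lt_or_gt_of_ne hij with hlt | hgt
  · -- `i < j`
    by_cases hex : ∃ c, c ≤ i ∧ i < σ c
    · obtain ⟨c, hc, hc'⟩ := hex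
      have h1 := hle c
      have h2 := hu i (σ c) hc'.le
      have h3 := hv c i hc
      have h4 := hv i j hlt.le
      rw [← h] at h4
      have := huniq (σ c) (by omega) (by omega)
      exact hc'.ne' this
    · push Not at hex
      have hsub : (insert j (Finset.Iic i)).image σ ⊆ Finset.Iic i := by
        intro x hx
        simp only [Finset.mem_image, Finset.mem_insert, Finset.mem_Iic] at hx ⊢
        obtain ⟨c, rfl | hc, rfl⟩ := hx
        · exact hσj.le
        · exact hex c hc
      have := Finset.card_le_card hsub
      rw [Finset.card_image_of_injective _ σ.injective, Finset.card_insert_of_notMem] at this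
      · omega
      · simpa using hlt
  · by_cases hex : ∃ c, i ≤ c ∧ σ c < i
    · obtain ⟨c, hc, hc'⟩ := hex
      have h1 := hle c
      have h2 := hu (σ c) i hc'.le
      have h3 := hv i c hc
      have h4 := hv j i hgt.le
      rw [← h] at h4
      have := huniq (σ c) (by omega) (by omega)
      exact hc'.ne this
    · push Not at hex
      have hsub : (insert j (Finset.Ici i)).image σ ⊆ Finset.Ici i := by
        intro x hx
        simp only [Finset.mem_image, Finset.mem_insert, Finset.mem_Ici] at hx ⊢
        obtain ⟨c, rfl | hc, rfl⟩ := hx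
        · exact hσj.ge
        · exact hex c hc
      have := Finset.card_le_card hsub
      rw [Finset.card_image_of_injective _ σ.injective, Finset.card_insert_of_notMem] at this
      · omega
      · simpa using hgt

theorem HM_det_delete (X : ℤ × ℤ → ℝ) {k : ℕ} (u v : Fin (k + 1) → ℤ × ℤ) (i : Fin (k + 1))
    (hinj : Function.Injective u)
    (hmin : ∀ j, (u i).1 + (u i).2 ≤ (u j).1 + (u j).2) (huv : u i = v i) :
    (HM X u v).det =
      X (u i) * (HM X (fun j => u (i.succAbove j)) (fun j => v (i.succAbove j))).det := by
  rw [Matrix.det_succ_column _ i, Finset.sum_eq_single i]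
  · have e : (HM X u v) i i = X (u i) := by
      simp [HM, ← huv, hh_self]
    rw [e, ← two_mul, pow_mul]
    simp only [even_two, Even.neg_pow, one_pow, one_mul]
    rfl
  · intro l _ hl
    have e : (HM X u v) l i = 0 := by
      apply hh_zero
      rw [← huv]
      intro h
      have := hmin l
      exact hl (hinj (Prod.ext (by omega) (by omega)))
    rw [e]; ring
  · simp

theorem HM_det_peel (X : ℤ × ℤ → ℝ) {k : ℕ} (u v : Fin k → ℤ × ℤ) (i : Fin k)
    (huv : ∀ j, u i ≠ v j) :
    (HM X u v).det = X (u i) * ((HM X (Function.update u i ((u i).1 + 1, (u i).2)) v).det +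
      (HM X (Function.update u i ((u i).1, (u i).2 + 1)) v).det) := by
  have hup : ∀ p, HM X (Function.update u i p) v =
      (HM X u v).updateRow i (fun j => hh X p (v j)) := by
    intro p
    ext a b
    by_cases hai : a = i
    · subst hai; simp [HM]
    · simp [HM, hai]
  rw [hup, hup, ← Matrix.det_updateRow_add, ← Matrix.det_updateRow_smul]
  congr 1
  ext a b
  by_cases hai : a = i
  · subst hai
    simp [HM, hh_start X _ _ (huv b), mul_add]
  · simp [HM, hai]

theorem NWSE_update {k : ℕ} (u : Fin k → ℤ × ℤ) (hu : NWSE u) (hinj : Function.Injective u)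
    (i : Fin k) (hmin : ∀ l, (u i).1 + (u i).2 ≤ (u l).1 + (u l).2) :
    NWSE (Function.update u i ((u i).1 + 1, (u i).2)) ∧
    NWSE (Function.update u i ((u i).1, (u i).2 + 1)) := by
  have h1 : ∀ j, i ≤ j → j ≠ i → (u i).1 + 1 ≤ (u j).1 := by
    intro j hij hne
    have a := hu i j hij
    have b := hmin j
    by_contra hc
    exact hne (hinj (Prod.ext (by omega) (by omega)))
  have h2 : ∀ j, j ≤ i → j ≠ i → (u i).2 + 1 ≤ (u j).2 := by
    intro j hij hne
    have a := hu j i hij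
    have b := hmin j
    by_contra hc
    exact hne (hinj (Prod.ext (by omega) (by omega)))
  constructor
  · intro a b hab
    have hb := hu a b hab
    by_cases ha : a = i
    · subst ha
      by_cases hb' : b = a
      · subst hb'; simp
      · simp only [Function.update_self, Function.update_of_ne hb']
        exact ⟨h1 b hab hb', hb.2⟩
    · by_cases hb' : b = i
      · subst hb'
        simp only [Function.update_self, Function.update_of_ne ha]
        exact ⟨by omega, hb.2⟩
      · simpa only [Function.update_of_ne ha, Function.update_of_ne hb'] using hb
  · intro a b hab
    have hb := hu a b hab
    by_cases ha : a = i
    · subst ha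
      by_cases hb' : b = a
      · subst hb'; simp
      · simp only [Function.update_self, Function.update_of_ne hb']
        exact ⟨hb.1, by omega⟩
    · by_cases hb' : b = i
      · subst hb'
        simp only [Function.update_self, Function.update_of_ne ha]
        exact ⟨hb.1, h2 a hab ha⟩
      · simpa only [Function.update_of_ne ha, Function.update_of_ne hb'] using hb

theorem LGV_aux (X : ℤ × ℤ → ℝ) (S : ℤ) (N : ℕ) : ∀ (k : ℕ) (u v : Fin k → ℤ × ℤ),
    NWSE u → NWSE v → (∀ j, (v j).1 + (v j).2 < S) →
    k + ∑ i, (S - ((u i).1 + (u i).2)).toNat < N → TT X u v = (HM X u v).det := by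
  induction N with
  | zero => intro k u v _ _ _ h; simp at h
  | succ N ih =>
    intro k u v hu hv hS hN
    by_cases hinj : Function.Injective u
    swap
    · simp only [Function.Injective, not_forall] at hinj
      obtain ⟨i, j, hij, hne⟩ := hinj
      rw [TT_not_inj_start X u v i j hne hij, Matrix.det_zero_of_row_eq hne]
      funext l
      simp [HM, hij]
    cases k with
    | zero => rw [TT_zero, Matrix.det_fin_zero]
    | succ k =>
      obtain ⟨i, -, hi⟩ := Finset.exists_min_image Finset.univ
        (fun l => (u l).1 + (u l).2) ⟨0, Finset.mem_univ _⟩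
      have hmin : ∀ l, (u i).1 + (u i).2 ≤ (u l).1 + (u l).2 := fun l => hi l (Finset.mem_univ l)
      by_cases hhit : ∃ j, u i = v j
      · obtain ⟨j, hj⟩ := hhit
        by_cases hij : i = j
        · subst hij
          rw [TT_delete X u v i hinj hmin hj, HM_det_delete X u v i hinj hmin hj]
          congr 1
          apply ih
          · exact fun a b hab => hu _ _ ((Fin.strictMono_succAbove i).monotone hab)
          · exact fun a b hab => hv _ _ ((Fin.strictMono_succAbove i).monotone hab)
          · exact fun a => hS _
          · rw [Fin.sum_univ_succAbove _ i] at hN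
            omega
        · rw [TT_start_hits_end X u v i j hij hj, HM_det_hit X u v hu hv hinj i j hmin hij hj]
      · push Not at hhit
        by_cases hSi : (u i).1 + (u i).2 < S
        · obtain ⟨n1, n2⟩ := NWSE_update u hu hinj i hmin
          have hsum : ∀ p : ℤ × ℤ, p.1 + p.2 = (u i).1 + (u i).2 + 1 →
              k + 1 + ∑ l, (S - ((Function.update u i p l).1 +
                (Function.update u i p l).2)).toNat < N := by
            intro p hp
            rw [Fin.sum_univ_succAbove _ i] at hN ⊢
            simp only [Function.update_self, Function.update_of_ne (Fin.succAbove_ne i _)]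
            omega
          rw [TT_peel X u v i hinj hmin (hhit i), HM_det_peel X u v i hhit,
            ih _ _ v n1 hv hS (hsum _ (by simp only; ring)),
            ih _ _ v n2 hv hS (hsum _ (by simp only; ring))]
        · rw [TT_eq_zero, Matrix.det_eq_zero_of_row_eq_zero i]
          · intro j
            apply hh_zero
            have := hS j
            omega
          · intro γ hγ
            have := path_le (hγ.1 i) _ (path_end_mem (hγ.1 i))
            have := hS i
            omega

theorem LGV (X : ℤ × ℤ → ℝ) {k : ℕ} (u v : Fin k → ℤ × ℤ) (hu : NWSE u) (hv : NWSE v) :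
    TT X u v = (HM X u v).det := by
  obtain ⟨S, hS⟩ := (Set.finite_range (fun j => (v j).1 + (v j).2)).bddAbove
  exact LGV_aux X (S + 1) _ k u v hu hv
    (fun j => Int.lt_add_one_of_le (hS ⟨j, rfl⟩)) (Nat.lt_succ_self _)

/-! ### Sylvester / Desnanot–Jacobi via Schur complements -/

theorem det_schur {K p : ℕ} (M : Matrix (Fin (K + p)) (Fin (K + p)) ℝ)
    (A : Matrix (Fin K) (Fin K) ℝ) (hA : A.det ≠ 0)
    (hMA : ∀ i j, M (Fin.castAdd p i) (Fin.castAdd p j) = A i j) :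
    M.det = A.det * (Matrix.of fun a b : Fin p => M (Fin.natAdd K a) (Fin.natAdd K b) -
      ∑ j, (∑ i, M (Fin.natAdd K a) (Fin.castAdd p i) * A⁻¹ i j) *
        M (Fin.castAdd p j) (Fin.natAdd K b)).det := by
  have : Invertible A := Matrix.invertibleOfIsUnitDet A (isUnit_iff_ne_zero.2 hA)
  rw [← Matrix.det_submatrix_equiv_self (finSumFinEquiv (m := K) (n := p)) M]
  have e : M.submatrix finSumFinEquiv finSumFinEquiv = Matrix.fromBlocks A
      (Matrix.of fun i b => M (Fin.castAdd p i) (Fin.natAdd K b))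
      (Matrix.of fun a j => M (Fin.natAdd K a) (Fin.castAdd p j))
      (Matrix.of fun a b => M (Fin.natAdd K a) (Fin.natAdd K b)) := by
    ext a b
    rcases a with a | a <;> rcases b with b | b <;> simp [hMA]
  rw [e, Matrix.det_fromBlocks₁₁, Matrix.invOf_eq_nonsing_inv]
  congr 2

noncomputable def schur (X : ℤ × ℤ → ℝ) {K : ℕ} (u v : Fin K → ℤ × ℤ) (p q : ℤ × ℤ) : ℝ :=
  hh X p q - ∑ j, (∑ i, hh X p (v i) * (HM X u v)⁻¹ i j) * hh X (u j) q

theorem HM_snoc_one (X : ℤ × ℤ → ℝ) {K : ℕ} (u v : Fin K → ℤ × ℤ)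
    (u' v' : Fin (K + 1) → ℤ × ℤ) (p q : ℤ × ℤ)
    (hu : ∀ i : Fin K, u' (Fin.castAdd 1 i) = u i) (hv : ∀ i : Fin K, v' (Fin.castAdd 1 i) = v i)
    (hp : u' (Fin.natAdd K 0) = p) (hq : v' (Fin.natAdd K 0) = q)
    (hA : (HM X u v).det ≠ 0) :
    (HM X u' v').det = (HM X u v).det * schur X u v p q := by
  rw [det_schur (HM X u' v') (HM X u v) hA (fun i j => by simp only [HM, Matrix.of_apply, hu, hv]),
    Matrix.det_fin_one]
  congr 1
  simp only [Matrix.of_apply]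
  unfold schur
  congr 1
  · simp only [HM, Matrix.of_apply, hp, hq]
  · refine Finset.sum_congr rfl (fun j _ => ?_)
    congr 1
    · refine Finset.sum_congr rfl (fun i _ => ?_)
      congr 1
      simp only [HM, Matrix.of_apply, hp, hv]
    · simp only [HM, Matrix.of_apply, hu, hq]

theorem HM_snoc_two (X : ℤ × ℤ → ℝ) {K : ℕ} (u v : Fin K → ℤ × ℤ)
    (u' v' : Fin (K + 2) → ℤ × ℤ) (p q : Fin 2 → ℤ × ℤ)
    (hu : ∀ i : Fin K, u' (Fin.castAdd 2 i) = u i) (hv : ∀ i : Fin K, v' (Fin.castAdd 2 i) = v i)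
    (hp : ∀ a, u' (Fin.natAdd K a) = p a) (hq : ∀ a, v' (Fin.natAdd K a) = q a)
    (hA : (HM X u v).det ≠ 0) :
    (HM X u' v').det = (HM X u v).det * (schur X u v (p 0) (q 0) * schur X u v (p 1) (q 1) -
      schur X u v (p 0) (q 1) * schur X u v (p 1) (q 0)) := by
  rw [det_schur (HM X u' v') (HM X u v) hA (fun i j => by simp only [HM, Matrix.of_apply, hu, hv])]
  have e : (Matrix.of fun a b : Fin 2 => (HM X u' v') (Fin.natAdd K a) (Fin.natAdd K b) -
      ∑ j, (∑ i, (HM X u' v') (Fin.natAdd K a) (Fin.castAdd 2 i) * (HM X u v)⁻¹ i j) *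
        (HM X u' v') (Fin.castAdd 2 j) (Fin.natAdd K b)) =
      Matrix.of fun a b : Fin 2 => schur X u v (p a) (q b) := by
    ext a b
    simp only [Matrix.of_apply]
    unfold schur
    congr 1
    · simp only [HM, Matrix.of_apply, hp, hq]
    · refine Finset.sum_congr rfl (fun j _ => ?_)
      congr 1
      · refine Finset.sum_congr rfl (fun i _ => ?_)
        congr 1
        simp only [HM, Matrix.of_apply, hp, hv]
      · simp only [HM, Matrix.of_apply, hu, hq]
  rw [e, Matrix.det_fin_two]
  simp only [Matrix.of_apply]

/-! ### Comparing the two corner configurations -/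

noncomputable def cc (x : ℕ → ℕ → ℝ) : ℕ → ℕ → ℕ → ℕ → ℝ
  | 0, _, b, s => if b = s then 1 else 0
  | (t + 1), a, b, s => x a b * (cc x t (a + 1) b s + cc x t a (b + 1) s)

theorem cc_lt (x : ℕ → ℕ → ℝ) (t : ℕ) : ∀ a b s, s < b → cc x t a b s = 0 := by
  induction t with
  | zero => intro a b s h; rw [cc, if_neg (by omega)]
  | succ t ih => intro a b s h; rw [cc, ih _ _ _ h, ih _ _ _ (by omega)]; simp

theorem cc_gt (x : ℕ → ℕ → ℝ) (t : ℕ) : ∀ a b s, b + t < s → cc x t a b s = 0 := by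
  induction t with
  | zero => intro a b s h; rw [cc, if_neg (by omega)]
  | succ t ih => intro a b s h; rw [cc, ih _ _ _ (by omega), ih _ _ _ (by omega)]; simp

theorem cc_left (x : ℕ → ℕ → ℝ) (t : ℕ) : ∀ a b,
    cc x t a b b = ∏ r ∈ Finset.range t, x (a + r) b := by
  induction t with
  | zero => intro a b; simp [cc]
  | succ t ih =>
    intro a b
    rw [cc, ih, cc_lt x t a (b + 1) b (by omega), Finset.prod_range_succ', add_zero, mul_comm]
    congr 1
    exact Finset.prod_congr rfl (fun r _ => by congr 1; omega)

theorem cc_right (x : ℕ → ℕ → ℝ) (t : ℕ) : ∀ a b,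
    cc x t a b (b + t) = ∏ r ∈ Finset.range t, x a (b + r) := by
  induction t with
  | zero => intro a b; simp [cc]
  | succ t ih =>
    intro a b
    have e : b + (t + 1) = b + 1 + t := by omega
    rw [cc, cc_gt x t (a + 1) b _ (by omega), e, ih, Finset.prod_range_succ', zero_add, mul_comm]
    congr 1
    exact Finset.prod_congr rfl (fun r _ => by congr 1; omega)

theorem cc_expand {k : ℕ} (x : ℕ → ℕ → ℝ) (f : ℕ → ℕ → ℝ)
    (hf : ∀ a b, a + b + 1 < k → f a b = x a b * (f (a + 1) b + f a (b + 1))) (t : ℕ) :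
    ∀ a b, a + b + t + 1 = k → f a b = ∑ s : Fin k, f (k - 1 - s) s * cc x t a b s := by
  induction t with
  | zero =>
    intro a b h
    rw [Finset.sum_eq_single (⟨b, by omega⟩ : Fin k)]
    · simp only [cc, if_true, mul_one]
      congr 1
      omega
    · intro s _ hs
      rw [cc, if_neg, mul_zero]
      intro hbs
      exact hs (Fin.ext hbs.symm)
    · simp
  | succ t ih =>
    intro a b h
    rw [hf a b (by omega), ih (a + 1) b (by omega), ih a (b + 1) (by omega),
      ← Finset.sum_add_distrib, Finset.mul_sum]
    refine Finset.sum_congr rfl (fun s _ => ?_)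
    rw [cc]
    ring

theorem corner_det {k : ℕ} (x : ℕ → ℕ → ℝ) (f : Fin k → ℕ → ℕ → ℝ)
    (hf : ∀ l a b, a + b + 1 < k → f l a b = x a b * (f l (a + 1) b + f l a (b + 1))) :
    (Matrix.of fun l j : Fin k => f l 0 j).det =
      (Matrix.of fun l j : Fin k => f l (k - 1 - j) 0).det := by
  set A : Matrix (Fin k) (Fin k) ℝ := Matrix.of fun l s => f l (k - 1 - s) s with hA
  set C : Matrix (Fin k) (Fin k) ℝ := Matrix.of fun s j => cc x (k - 1 - j) 0 j s with hC
  set C' : Matrix (Fin k) (Fin k) ℝ := Matrix.of fun s j => cc x j (k - 1 - j) 0 s with hC'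
  have e1 : (Matrix.of fun l j : Fin k => f l 0 j) = A * C := by
    ext l j
    simp only [Matrix.mul_apply, hA, hC, Matrix.of_apply]
    exact cc_expand x (f l) (hf l) _ _ _ (by omega)
  have e2 : (Matrix.of fun l j : Fin k => f l (k - 1 - j) 0) = A * C' := by
    ext l j
    simp only [Matrix.mul_apply, hA, hC', Matrix.of_apply]
    exact cc_expand x (f l) (hf l) _ _ _ (by omega)
  have d1 : C.det = ∏ j : Fin k, ∏ r ∈ Finset.range (k - 1 - j), x r j := by
    rw [Matrix.det_of_isLowerTriangular C]
    · refine Finset.prod_congr rfl (fun j _ => ?_)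
      simp only [hC, Matrix.of_apply, cc_left, zero_add]
    · intro s j hsj
      exact cc_lt _ _ _ _ _ hsj
  have d2 : C'.det = ∏ j : Fin k, ∏ r ∈ Finset.range j, x (k - 1 - j) r := by
    rw [Matrix.det_of_isUpperTriangular (M := C')]
    · refine Finset.prod_congr rfl (fun j _ => ?_)
      have := cc_right x j (k - 1 - j) 0
      simp only [zero_add] at this
      simp only [hC', Matrix.of_apply, this]
    · intro s j hsj
      apply cc_gt
      rw [zero_add]
      exact hsj
  rw [e1, e2, Matrix.det_mul, Matrix.det_mul, d1, d2]
  congr 1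
  rw [Fin.prod_univ_eq_prod_range (fun j => ∏ r ∈ Finset.range (k - 1 - j), x r j),
    Fin.prod_univ_eq_prod_range (fun j => ∏ r ∈ Finset.range j, x (k - 1 - j) r),
    ← Finset.prod_range_reflect (fun j => ∏ r ∈ Finset.range j, x (k - 1 - j) r)]
  have e3 : ∏ j ∈ Finset.range k, ∏ r ∈ Finset.range (k - 1 - j), x (k - 1 - (k - 1 - j)) r =
      ∏ j ∈ Finset.range k, ∏ r ∈ Finset.range (k - 1 - j), x j r := by
    refine Finset.prod_congr rfl (fun j hj => ?_)
    rw [Finset.mem_range] at hj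
    have : k - 1 - (k - 1 - j) = j := by omega
    rw [this]
  rw [e3]
  apply Finset.prod_comm'
  intro a b
  simp only [Finset.mem_range]
  omega

/-! ### The special endpoint lists -/

theorem botList_NWSE (k : ℕ) : NWSE (botList k) := by
  intro i j hij
  have : (i : ℕ) ≤ j := hij
  simp only [botList]
  omega

theorem topList_NWSE (m n : ℤ) (k : ℕ) : NWSE (topList m n k) := by
  intro i j hij
  have : (i : ℕ) ≤ j := hij
  simp only [topList]
  omega

theorem startList_NWSE (a : ℤ) (k : ℕ) (h : (k : ℤ) ≤ a + 1) : NWSE (startList a k) := by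
  intro i j hij
  have : (i : ℕ) ≤ j := hij
  have hi := i.2
  have hj := j.2
  simp only [startList]
  split_ifs <;> simp only <;> omega

theorem endList_NWSE (m n b : ℤ) (k : ℕ) (h : (k : ℤ) ≤ n - b + 2) : NWSE (endList m n b k) := by
  intro i j hij
  have : (i : ℕ) ≤ j := hij
  have hi := i.2
  have hj := j.2
  simp only [endList]
  split_ifs <;> simp only <;> omega

theorem Tk_eq (X : ℤ × ℤ → ℝ) (k : ℕ) (m n : ℤ) (hkn : (k : ℤ) ≤ n) :
    Tk X k (1, 1) (m, n) = TT X (botList k) (topList m n k) := by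
  unfold Tk
  split_ifs with hk
  · subst hk
    rw [TT_zero]
  · have hb : (fun i : Fin k => (((1 : ℤ), (1 : ℤ)).1 + ((i : ℕ) : ℤ), ((1 : ℤ), (1 : ℤ)).2)) =
        botList k := by
      funext i
      simp only [botList]
      rw [add_comm]
    rw [hb, LGV X _ _ (botList_NWSE k), LGV X _ _ (botList_NWSE k) (topList_NWSE m n k)]
    · have := corner_det (k := k) (fun a b => X (m - a, n - b))
        (fun l a b => hh X (botList k l) (m - a, n - b)) ?_
      · have e1 : HM X (botList k) (topList m n k) = Matrix.of fun l j : Fin k =>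
            hh X (botList k l) (m - (0 : ℕ), n - (j : ℕ)) := by
          ext l j
          simp [HM, topList]
        rw [e1, this]
        congr 1
        ext l j
        simp only [HM, Matrix.of_apply]
        congr 1
        have := j.2
        ext
        · simp only; omega
        · simp
      · intro l a b hab
        rw [hh_end]
        · push_cast
          simp only [sub_sub]
        · intro h
          have := congrArg Prod.snd h
          simp only [botList] at this
          omega
    · intro i j hij
      have : (i : ℕ) ≤ j := hij
      simp only
      omega

/-! ### Positivity -/

theorem exists_hook (v : ℤ × ℤ) (N : ℕ) : ∀ u : ℤ × ℤ, u.1 ≤ v.1 → u.2 ≤ v.2 →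
    v.1 + v.2 - (u.1 + u.2) < N → ∃ γ, IsDirPath UpStep γ u v ∧
      ∀ w ∈ γ, (w.1 = u.1 ∧ w.2 ≤ v.2) ∨ (w.2 = v.2 ∧ u.1 ≤ w.1) := by
  induction N with
  | zero => intro u h1 h2 h; push_cast at h; omega
  | succ N ih =>
    intro u h1 h2 h
    push_cast at h
    by_cases huv : u = v
    · subst huv
      exact ⟨[u], (path_self_iff _ _).2 rfl, by simp⟩
    · by_cases h3 : u.2 < v.2
      · obtain ⟨γ, hγ, hw⟩ := ih (u.1, u.2 + 1) h1 h3 (by simp only; omega)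
        refine ⟨u :: γ, (path_iff_of_ne huv _).2 ⟨γ, rfl, Or.inr hγ⟩, ?_⟩
        intro w hwm
        rcases List.mem_cons.1 hwm with rfl | hwm
        · exact Or.inl ⟨rfl, h2⟩
        · exact hw w hwm
      · have h4 : u.1 < v.1 := by
          by_contra hc
          exact huv (Prod.ext (by omega) (by omega))
        obtain ⟨γ, hγ, hw⟩ := ih (u.1 + 1, u.2) h4 h2 (by simp only; omega)
        refine ⟨u :: γ, (path_iff_of_ne huv _).2 ⟨γ, rfl, Or.inl hγ⟩, ?_⟩
        intro w hwm
        rcases List.mem_cons.1 hwm with rfl | hwm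
        · exact Or.inl ⟨rfl, h2⟩
        · have hl := path_le hγ w hwm
          have := hw w hwm
          simp only at this hl
          right
          omega

theorem TT_pos (X : ℤ × ℤ → ℝ) (hX : ∀ w, 0 < X w) {k : ℕ} (u v : Fin k → ℤ × ℤ)
    (h : (DisjointPathTuples UpStep u v).Nonempty) : 0 < TT X u v := by
  obtain ⟨γ, hγ⟩ := h
  have : Finite (DisjointPathTuples UpStep u v) := tuples_finite u v
  have hp : ∀ γ : Fin k → List (ℤ × ℤ), 0 < tupleWeight X γ :=
    fun γ => Finset.prod_pos (fun w _ => hX w)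
  exact Summable.tsum_pos Summable.of_finite (fun γ => (hp _).le) ⟨γ, hγ⟩ (hp _)

theorem bot_top_pos (X : ℤ × ℤ → ℝ) (hX : ∀ w, 0 < X w) (k : ℕ) (m n : ℤ) (hkm : (k : ℤ) ≤ m)
    (hkn : (k : ℤ) ≤ n) : 0 < TT X (botList k) (topList m n k) := by
  apply TT_pos X hX
  have hex : ∀ i : Fin k, ∃ γ, IsDirPath UpStep γ (botList k i) (topList m n k i) ∧
      ∀ w ∈ γ, (w.1 = (botList k i).1 ∧ w.2 ≤ (topList m n k i).2) ∨
        (w.2 = (topList m n k i).2 ∧ (botList k i).1 ≤ w.1) := by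
    intro i
    have := i.2
    refine exists_hook _ (((topList m n k i).1 + (topList m n k i).2 -
      ((botList k i).1 + (botList k i).2)).toNat + 1) _ ?_ ?_ ?_
    · simp only [botList, topList]; omega
    · simp only [botList, topList]; omega
    · push_cast; omega
  choose γ h1 h2 using hex
  refine ⟨γ, h1, ?_⟩
  intro i j hij w hi hj
  have a := h2 i w hi
  have b := h2 j w hj
  simp only [botList, topList] at a b
  have : (i : ℕ) ≠ j := fun h => hij (Fin.ext h)
  omega

/-- **The rearrangement identity** (eq. `rearrange-k`). For strictly positive weights,
`1 ≤ a ≤ m`, `1 ≤ b ≤ n` and `1 ≤ k ≤ min(a, n-b+1)`: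
`T([(1,1)^{k-1},(a,1)],[(m,n)^k]) ⬝ T([(1,1)^k],[(m,n)^{k-1},(m,b)]) / (T_k ⬝ T_{k-1})
 = T([(1,1)^{k-1},(a,1)],[(m,n)^{k-1},(m,b)]) / T_{k-1}
   − T([(1,1)^k,(a,1)],[(m,n)^k,(m,b)]) / T_k`,
and when `k = min(a, n-b+1)` the subtracted term vanishes. -/
theorem rearrange_identity (X : ℤ × ℤ → ℝ) (hX : ∀ w, 0 < X w)
    (m n : ℤ) (hm : 1 ≤ m) (hn : 1 ≤ n) (a b k : ℤ)
    (ha1 : 1 ≤ a) (ham : a ≤ m) (hb1 : 1 ≤ b) (hbn : b ≤ n)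
    (hk1 : 1 ≤ k) (hk2 : k ≤ min a (n - b + 1)) :
    (TT X (startList a k.toNat) (topList m n k.toNat) *
        TT X (botList k.toNat) (endList m n b k.toNat) /
        (Tk X k.toNat (1, 1) (m, n) * Tk X (k - 1).toNat (1, 1) (m, n)) =
      TT X (startList a k.toNat) (endList m n b k.toNat) / Tk X (k - 1).toNat (1, 1) (m, n) -
        TT X (startList a (k.toNat + 1)) (endList m n b (k.toNat + 1)) /
          Tk X k.toNat (1, 1) (m, n)) ∧
    (k = min a (n - b + 1) →
      TT X (startList a (k.toNat + 1)) (endList m n b (k.toNat + 1)) = 0) := by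
  obtain ⟨K, rfl⟩ : ∃ K : ℕ, k = K + 1 := ⟨(k - 1).toNat, by omega⟩
  have e1 : ((K : ℤ) + 1).toNat = K + 1 := by omega
  have e2 : ((K : ℤ) + 1 - 1).toNat = K := by omega
  rw [e1, e2]
  have hka : (K : ℤ) + 1 ≤ a := le_trans hk2 (min_le_left _ _)
  have hkb : (K : ℤ) + 1 ≤ n - b + 1 := le_trans hk2 (min_le_right _ _)
  constructor
  · have p0 := bot_top_pos X hX K m n (by omega) (by omega)
    have p1 := bot_top_pos X hX (K + 1) m n (by push_cast; omega) (by push_cast; omega)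
    rw [Tk_eq X K m n (by omega), Tk_eq X (K + 1) m n (by push_cast; omega)]
    have s1 : NWSE (startList a (K + 1)) := startList_NWSE _ _ (by push_cast; omega)
    have s2 : NWSE (startList a (K + 1 + 1)) := startList_NWSE _ _ (by push_cast; omega)
    have t1 : NWSE (endList m n b (K + 1)) := endList_NWSE _ _ _ _ (by push_cast; omega)
    have t2 : NWSE (endList m n b (K + 1 + 1)) := endList_NWSE _ _ _ _ (by push_cast; omega)
    have b0 := botList_NWSE K
    have b1 := botList_NWSE (K + 1)
    have c0 := topList_NWSE m n K
    have c1 := topList_NWSE m n (K + 1)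
    rw [LGV X _ _ b0 c0] at p0 ⊢
    rw [LGV X _ _ b1 c1] at p1 ⊢
    rw [LGV X _ _ s1 c1, LGV X _ _ b1 t1, LGV X _ _ s1 t1, LGV X _ _ s2 t2]
    have hA := p0.ne'
    have hs1 : ∀ i : Fin K, startList a (K + 1) (Fin.castAdd 1 i) = botList K i := by
      intro i
      have := i.2
      simp only [startList, botList, Fin.val_castAdd]
      rw [if_neg (by omega)]
    have hs1' : startList a (K + 1) (Fin.natAdd K 0) = (a, 1) := by
      simp [startList]
    have ht1 : ∀ i : Fin K, endList m n b (K + 1) (Fin.castAdd 1 i) = topList m n K i := by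
      intro i
      have := i.2
      simp only [endList, topList, Fin.val_castAdd]
      rw [if_neg (by omega)]
    have ht1' : endList m n b (K + 1) (Fin.natAdd K 0) = (m, b) := by
      simp [endList]
    have hb1' : botList (K + 1) (Fin.natAdd K 0) = ((K : ℤ) + 1, 1) := by
      simp [botList]
    have hc1' : topList m n (K + 1) (Fin.natAdd K 0) = (m, n - (K : ℤ)) := by
      simp [topList]
    have hbb : ∀ i : Fin K, botList (K + 1) (Fin.castAdd 1 i) = botList K i := fun i => rfl
    have hcc : ∀ i : Fin K, topList m n (K + 1) (Fin.castAdd 1 i) = topList m n K i :=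
      fun i => rfl
    have hs2 : ∀ i : Fin K, startList a (K + 1 + 1) (Fin.castAdd 2 i) = botList K i := by
      intro i
      have := i.2
      simp only [startList, botList, Fin.val_castAdd]
      rw [if_neg (by omega)]
    have ht2 : ∀ i : Fin K, endList m n b (K + 1 + 1) (Fin.castAdd 2 i) = topList m n K i := by
      intro i
      have := i.2
      simp only [endList, topList, Fin.val_castAdd]
      rw [if_neg (by omega)]
    have hs2' : ∀ c : Fin 2, startList a (K + 1 + 1) (Fin.natAdd K c) =
        (![((K : ℤ) + 1, 1), (a, 1)] : Fin 2 → ℤ × ℤ) c := by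
      intro c
      fin_cases c <;> simp [startList]
    have ht2' : ∀ c : Fin 2, endList m n b (K + 1 + 1) (Fin.natAdd K c) =
        (![(m, n - (K : ℤ)), (m, b)] : Fin 2 → ℤ × ℤ) c := by
      intro c
      fin_cases c <;> simp [endList]
    rw [HM_snoc_two X _ _ _ _ _ _ hs2 ht2 hs2' ht2' hA,
      HM_snoc_one X _ _ _ _ _ _ hs1 hcc hs1' hc1' hA,
      HM_snoc_one X _ _ _ _ _ _ hbb ht1 hb1' ht1' hA,
      HM_snoc_one X _ _ _ _ _ _ hs1 ht1 hs1' ht1' hA]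
    rw [HM_snoc_one X _ _ _ _ _ _ hbb hcc hb1' hc1' hA] at p1 ⊢
    have hS := (mul_ne_zero_iff.1 p1.ne').2
    simp only [Matrix.cons_val_zero, Matrix.cons_val_one]
    field_simp
    ring
  · intro h
    rcases min_choice a (n - b + 1) with hc | hc
    · apply TT_not_inj_start X _ _ (Fin.castSucc (Fin.last K)) (Fin.last (K + 1))
      · exact (Fin.castSucc_lt_last _).ne
      · simp [startList]
        omega
    · apply TT_not_inj_end X _ _ (Fin.castSucc (Fin.last K)) (Fin.last (K + 1))
      · exact (Fin.castSucc_lt_last _).ne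
      · simp [endList]
        omega
end

section
/- (Desnanot–Jacobi identity for the last two indices.) Let n ≥ 2 and let M be an n×n matrix with real entries. For index sets I (rows) and J (columns), let M[I;J] denote the submatrix of M obtained by deleting the rows in I and the columns in J. Then det M · det M[{n−1,n};{n−1,n}] = det M[{n−1};{n−1}] · det M[{n};{n}] − det M[{n−1};{n}] · det M[{n};{n−1}]. -/
open Matrix in
/-- A bordered minor as a Schur complement. -/
lemma bordered_det (k : ℕ) (M : Matrix (Fin (k + 2)) (Fin (k + 2)) ℝ)
    (A : Matrix (Fin k) (Fin k) ℝ)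
    (hA : A = M.submatrix (fun i : Fin k => i.castSucc.castSucc)
          (fun j : Fin k => j.castSucc.castSucc)) [Invertible A]
    (r c : Fin (k + 1) → Fin (k + 2))
    (hr : ∀ i : Fin k, r i.castSucc = i.castSucc.castSucc)
    (hc : ∀ i : Fin k, c i.castSucc = i.castSucc.castSucc) :
    (M.submatrix r c).det = A.det * (M (r (Fin.last k)) (c (Fin.last k)) -
      ((fun j : Fin k => M (r (Fin.last k)) j.castSucc.castSucc) ᵥ* ⅟A) ⬝ᵥ
        (fun i : Fin k => M i.castSucc.castSucc (c (Fin.last k)))) := by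
  rw [← Matrix.det_submatrix_equiv_self (finSumFinEquiv : Fin k ⊕ Fin 1 ≃ Fin (k + 1))]
  have : (M.submatrix r c).submatrix (finSumFinEquiv : Fin k ⊕ Fin 1 ≃ Fin (k + 1))
      (finSumFinEquiv : Fin k ⊕ Fin 1 ≃ Fin (k + 1)) =
      fromBlocks A (of fun (i : Fin k) (_ : Fin 1) => M i.castSucc.castSucc (c (Fin.last k)))
        (of fun (_ : Fin 1) (j : Fin k) => M (r (Fin.last k)) j.castSucc.castSucc)
        (of fun (_ _ : Fin 1) => M (r (Fin.last k)) (c (Fin.last k))) := by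
    have h1 : ∀ i : Fin k, (Fin.castAdd 1 i) = i.castSucc := fun i => rfl
    have h2 : ∀ i : Fin 1, (Fin.natAdd k i) = Fin.last k := fun i => by
      ext; simp
    ext i j
    rcases i with i | i <;> rcases j with j | j <;> simp [h1, h2, hr, hc, hA]
  rw [this, det_fromBlocks₁₁]
  congr 1
  rw [det_fin_one]
  rfl

open Matrix in
lemma desnanot_inv (k : ℕ) (M : Matrix (Fin (k + 2)) (Fin (k + 2)) ℝ)
    (h : (M.submatrix (fun i : Fin k => i.castSucc.castSucc)
          (fun j : Fin k => j.castSucc.castSucc)).det ≠ 0) :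
    M.det *
        (M.submatrix (fun i : Fin k => i.castSucc.castSucc)
          (fun j : Fin k => j.castSucc.castSucc)).det =
      (M.submatrix (Fin.last k).castSucc.succAbove
            (Fin.last k).castSucc.succAbove).det *
          (M.submatrix (Fin.last (k + 1)).succAbove (Fin.last (k + 1)).succAbove).det -
        (M.submatrix (Fin.last k).castSucc.succAbove
            (Fin.last (k + 1)).succAbove).det *
          (M.submatrix (Fin.last (k + 1)).succAbove
            (Fin.last k).castSucc.succAbove).det := by
  obtain ⟨A, hA⟩ : ∃ A, A = M.submatrix (fun i : Fin k => i.castSucc.castSucc)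
          (fun j : Fin k => j.castSucc.castSucc) := ⟨_, rfl⟩
  rw [← hA] at h ⊢
  let _ : Invertible A := A.invertibleOfIsUnitDet (isUnit_iff_ne_zero.mpr h)
  have h1 : ∀ i : Fin k, (Fin.last k).castSucc.succAbove i.castSucc = i.castSucc.castSucc :=
    fun i => Fin.succAbove_of_castSucc_lt _ _ (by simp [Fin.lt_def])
  have h2 : ∀ i : Fin k, (Fin.last (k+1)).succAbove i.castSucc = i.castSucc.castSucc :=
    fun i => by simp
  have h3 : (Fin.last k).castSucc.succAbove (Fin.last k) = Fin.last (k + 1) := by simp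
  have h4 : (Fin.last (k+1)).succAbove (Fin.last k) = (Fin.last k).castSucc := by simp
  rw [bordered_det k M A hA _ _ h1 h1, bordered_det k M A hA _ _ h1 h2,
    bordered_det k M A hA _ _ h2 h1, bordered_det k M A hA _ _ h2 h2, h3, h4]
  rw [← Matrix.det_submatrix_equiv_self (finSumFinEquiv : Fin k ⊕ Fin 2 ≃ Fin (k + 2)) M]
  let f : Fin 2 → Fin (k + 2) := ![(Fin.last k).castSucc, Fin.last (k + 1)]
  have : M.submatrix (finSumFinEquiv : Fin k ⊕ Fin 2 ≃ Fin (k + 2))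
      (finSumFinEquiv : Fin k ⊕ Fin 2 ≃ Fin (k + 2)) =
      fromBlocks A (of fun (i : Fin k) (j : Fin 2) => M i.castSucc.castSucc (f j))
        (of fun (i : Fin 2) (j : Fin k) => M (f i) j.castSucc.castSucc)
        (of fun (i j : Fin 2) => M (f i) (f j)) := by
    have g1 : ∀ i : Fin k, (Fin.castAdd 2 i) = i.castSucc.castSucc := fun i => rfl
    have g2 : ∀ i : Fin 2, (Fin.natAdd k i) = f i := fun i => by
      fin_cases i <;> rfl
    ext i j
    rcases i with i | i <;> rcases j with j | j <;> simp [g1, g2, hA]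
  rw [this, det_fromBlocks₁₁, det_fin_two]
  have e : ∀ i j : Fin 2, ((of fun (i j : Fin 2) => M (f i) (f j)) -
      (of fun (i : Fin 2) (j : Fin k) => M (f i) j.castSucc.castSucc) * ⅟A *
      (of fun (i : Fin k) (j : Fin 2) => M i.castSucc.castSucc (f j))) i j =
      M (f i) (f j) - ((fun j : Fin k => M (f i) j.castSucc.castSucc) ᵥ* ⅟A) ⬝ᵥ
        (fun i : Fin k => M i.castSucc.castSucc (f j)) := fun i j => rfl
  simp only [e]
  have f0 : f 0 = (Fin.last k).castSucc := rfl
  have f1 : f 1 = Fin.last (k + 1) := rfl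
  rw [f0, f1]
  ring

/-- A continuous perturbation of `M` whose leading block is invertible for a dense set of times. -/
lemma exists_perturb (k : ℕ) (M : Matrix (Fin (k + 2)) (Fin (k + 2)) ℝ) :
    ∃ N : ℝ → Matrix (Fin (k + 2)) (Fin (k + 2)) ℝ, Continuous N ∧ N 0 = M ∧
      Dense {t : ℝ | ((N t).submatrix (fun i : Fin k => i.castSucc.castSucc)
          (fun j : Fin k => j.castSucc.castSucc)).det ≠ 0} := by
  let N : ℝ → Matrix (Fin (k + 2)) (Fin (k + 2)) ℝ := fun t => Matrix.scalar _ t + M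
  have hN : Continuous N := by
    refine Continuous.add ?_ continuous_const
    exact Continuous.matrix_diagonal (continuous_pi fun _ => continuous_id)
  have hN0 : N 0 = M := by simp [N]
  have hd : Dense {t : ℝ | ((N t).submatrix (fun i : Fin k => i.castSucc.castSucc)
          (fun j : Fin k => j.castSucc.castSucc)).det ≠ 0} := by
    let B := -(M.submatrix (fun i : Fin k => i.castSucc.castSucc)
          (fun j : Fin k => j.castSucc.castSucc))
    have hfin : {t : ℝ | B.charpoly.IsRoot t}.Finite :=
      Polynomial.finite_setOfPred_isRoot B.charpoly_monic.ne_zero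
    have := hfin.countable.dense_compl ℝ
    refine this.mono fun t ht => ?_
    simp only [Set.mem_compl_iff, Set.mem_ofPred_eq, Polynomial.IsRoot, Matrix.eval_charpoly] at ht
    convert ht using 3
    ext i j
    simp [N, B, Matrix.diagonal_apply]
  exact ⟨N, hN, hN0, hd⟩

/-- **Desnanot–Jacobi identity for the last two indices.** For an `n × n` real matrix `M` with
`n = k + 2 ≥ 2`, writing `M[I;J]` for the submatrix obtained by deleting the rows in `I` and the
columns in `J` (indices `n-1` and `n` being the last two),
`det M ⬝ det M[{n-1,n};{n-1,n}] = det M[{n-1};{n-1}] ⬝ det M[{n};{n}]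
  − det M[{n-1};{n}] ⬝ det M[{n};{n-1}]`. -/
theorem desnanot_jacobi_last_two (k : ℕ) (M : Matrix (Fin (k + 2)) (Fin (k + 2)) ℝ) :
    M.det *
        (M.submatrix (fun i : Fin k => i.castSucc.castSucc)
          (fun j : Fin k => j.castSucc.castSucc)).det =
      (M.submatrix (⟨k, by omega⟩ : Fin (k + 2)).succAbove
            (⟨k, by omega⟩ : Fin (k + 2)).succAbove).det *
          (M.submatrix (Fin.last (k + 1)).succAbove (Fin.last (k + 1)).succAbove).det -
        (M.submatrix (⟨k, by omega⟩ : Fin (k + 2)).succAbove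
            (Fin.last (k + 1)).succAbove).det *
          (M.submatrix (Fin.last (k + 1)).succAbove
            (⟨k, by omega⟩ : Fin (k + 2)).succAbove).det := by
  obtain ⟨N, hN, hN0, hd⟩ := exists_perturb k M
  have key := Continuous.ext_on hd (f := fun t => (N t).det *
        ((N t).submatrix (fun i : Fin k => i.castSucc.castSucc)
          (fun j : Fin k => j.castSucc.castSucc)).det)
    (g := fun t => ((N t).submatrix (Fin.last k).castSucc.succAbove
            (Fin.last k).castSucc.succAbove).det *
          ((N t).submatrix (Fin.last (k + 1)).succAbove (Fin.last (k + 1)).succAbove).det -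
        ((N t).submatrix (Fin.last k).castSucc.succAbove
            (Fin.last (k + 1)).succAbove).det *
          ((N t).submatrix (Fin.last (k + 1)).succAbove
            (Fin.last k).castSucc.succAbove).det)
    (hN.matrix_det.mul (hN.matrix_submatrix _ _).matrix_det)
    (((hN.matrix_submatrix _ _).matrix_det.mul (hN.matrix_submatrix _ _).matrix_det).sub
      ((hN.matrix_submatrix _ _).matrix_det.mul (hN.matrix_submatrix _ _).matrix_det))
    (fun t ht => desnanot_inv k (N t) ht)
  have h0 := congrFun key 0
  simp only [hN0] at h0
  exact h0
end
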